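/- A split of K₆ minus an edge is W₆-minor-free if and only if it is isomorphic to K^{3,1}_{4,3} or to K^{4,1}_{4,3}. -/

import Mathlib

open SimpleGraph

/-- `H` is a minor of `G`: there is a family of nonempty, pairwise disjoint,
connected branch sets in `G`, one for each vertex of `H`, such that adjacent
vertices of `H` have branch sets joined by an edge of `G`. -/
def SimpleGraph.IsMinorOf {W V : Type*} (H : SimpleGraph W) (G : SimpleGraph V) : Prop :=
  ∃ φ : W → Set V,
    (∀ w, (φ w).Nonempty) ∧
    (∀ w, (G.induce (φ w)).Connected) ∧
    (Pairwise fun w₁ w₂ => Disjoint (φ w₁) (φ w₂)) ∧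
    (∀ ⦃w₁ w₂⦄, H.Adj w₁ w₂ → ∃ a ∈ φ w₁, ∃ b ∈ φ w₂, G.Adj a b)

/-- The wheel `Wₙ`: a hub (`none`) joined to every vertex of a cycle of length `n`. -/
def wheel (n : ℕ) : SimpleGraph (Option (ZMod n)) :=
  SimpleGraph.fromRel fun a b =>
    (a = none ∧ b ≠ none) ∨ (∃ i j : ZMod n, a = some i ∧ b = some j ∧ j = i + 1)

/-- `K₆` minus an edge. -/
def K6e : SimpleGraph (Fin 6) := (⊤ : SimpleGraph (Fin 6)).deleteEdges {s(0, 1)}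

/-- `K^{3,0}_{4,3}`: `K_{4,3}` plus three edges forming a path on the four
vertices of the part of size four. -/
def K43_30 : SimpleGraph (Fin 4 ⊕ Fin 3) :=
  SimpleGraph.fromRel fun a b =>
    match a, b with
    | .inl _, .inr _ => True
    | .inr _, .inl _ => True
    | .inl i, .inl j => (j : ℕ) = (i : ℕ) + 1
    | .inr _, .inr _ => False

/-- `K^{3,1}_{4,3}`: `K^{3,0}_{4,3}` plus one edge between two vertices of
the part of size three. -/
def K43_31 : SimpleGraph (Fin 4 ⊕ Fin 3) :=
  SimpleGraph.fromRel fun a b =>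
    match a, b with
    | .inl _, .inr _ => True
    | .inr _, .inl _ => True
    | .inl i, .inl j => (j : ℕ) = (i : ℕ) + 1
    | .inr i, .inr j => i = 0 ∧ j = 1

/-- `K^{4,0}_{4,3}`: `K_{4,3}` plus four edges forming a cycle on the four
vertices of the part of size four. -/
def K43_40 : SimpleGraph (Fin 4 ⊕ Fin 3) :=
  SimpleGraph.fromRel fun a b =>
    match a, b with
    | .inl _, .inr _ => True
    | .inr _, .inl _ => True
    | .inl i, .inl j => j = i + 1
    | .inr _, .inr _ => False

/-- `K^{4,1}_{4,3}`: `K^{4,0}_{4,3}` plus one edge between two vertices of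
the part of size three. -/
def K43_41 : SimpleGraph (Fin 4 ⊕ Fin 3) :=
  SimpleGraph.fromRel fun a b =>
    match a, b with
    | .inl _, .inr _ => True
    | .inr _, .inl _ => True
    | .inl i, .inl j => j = i + 1
    | .inr i, .inr j => i = 0 ∧ j = 1

/-- The split of a vertex `v` of `G` determined by `X, Y ⊆ N(v)`:
delete `v`, and add two new adjacent vertices (`inr 0` and `inr 1`) joined
to all vertices of `X` and of `Y` respectively. -/
def splitGraph {V : Type*} (G : SimpleGraph V) (v : V) (X Y : Set V) :
    SimpleGraph ({u : V // u ≠ v} ⊕ Fin 2) :=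
  SimpleGraph.fromRel fun a b =>
    match a, b with
    | .inl u, .inl u' => G.Adj u u'
    | .inl u, .inr i => (i = 0 ∧ (u : V) ∈ X) ∨ (i = 1 ∧ (u : V) ∈ Y)
    | .inr _, .inl _ => False
    | .inr _, .inr _ => True

/-- The side conditions on the data of a split of a vertex `v`:
`X, Y ⊆ N(v)`, `X ∪ Y = N(v)` and `|X|, |Y| ≥ 3`. -/
def IsSplitData {V : Type*} (G : SimpleGraph V) (v : V) (X Y : Set V) : Prop :=
  X ⊆ G.neighborSet v ∧ Y ⊆ G.neighborSet v ∧ X ∪ Y = G.neighborSet v ∧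
    3 ≤ X.ncard ∧ 3 ≤ Y.ncard

namespace SimpleGraph

variable {V W : Type*} {G : SimpleGraph V} {H : SimpleGraph W}

theorem IsContained.isMinorOf (h : H ⊑ G) : H.IsMinorOf G := by
  obtain ⟨f⟩ := h
  refine ⟨fun w => {f w}, fun w => Set.singleton_nonempty _, fun w => ?_, fun a b hab => ?_,
    fun a b hab => ⟨_, rfl, _, rfl, f.toHom.map_adj hab⟩⟩
  · have : Subsingleton ({f w} : Set V) := Set.subsingleton_coe _ |>.2 Set.subsingleton_singleton
    exact ⟨Preconnected.of_subsingleton⟩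
  · exact Set.disjoint_singleton.2 (f.injective.ne hab)

theorem IsMinorOf.isContained [Finite V] (h : H.IsMinorOf G) (hc : Nat.card V ≤ Nat.card W) :
    H ⊑ G := by
  obtain ⟨φ, hne, -, hdisj, hadj⟩ := h
  choose f hf using hne
  have key : ∀ {a b x}, x ∈ φ a → x ∈ φ b → a = b := fun ha hb => by
    by_contra hab
    exact Set.disjoint_left.1 (hdisj hab) ha hb
  have hinj : Function.Injective f := fun a b hab => key (hf a) (hab ▸ hf b)
  have hsurj : Function.Surjective f :=
    (hinj.bijective_of_nat_card_le hc).2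
  refine ⟨⟨⟨f, fun {a b} hab => ?_⟩, hinj⟩⟩
  obtain ⟨x, hx, y, hy, hxy⟩ := hadj hab
  obtain ⟨a', rfl⟩ := hsurj x
  obtain ⟨b', rfl⟩ := hsurj y
  rwa [key (hf a') hx, key (hf b') hy] at hxy

theorem wheel_isContained {n : ℕ} (u : V) (c : ZMod n → V) (hc : Function.Injective c)
    (hcyc : ∀ i, G.Adj (c i) (c (i + 1))) (hu : ∀ i, G.Adj u (c i)) : wheel n ⊑ G := by
  refine ⟨⟨⟨fun o => o.elim u c, fun {a b} hab => ?_⟩, ?_⟩⟩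
  · rcases a with _ | a <;> rcases b with _ | b <;> simp [wheel] at hab ⊢
    · exact hu b
    · exact (hu a).symm
    · obtain ⟨-, rfl | rfl⟩ := hab
      · exact hcyc a
      · exact (hcyc b).symm
  · rintro (_ | a) (_ | b) hab
    · rfl
    · exact absurd hab (hu b).ne
    · exact absurd hab (hu a).ne'
    · exact congrArg some (hc hab)

/-- In a graph with `n + 1` vertices, the hub of a wheel minor `Wₙ` is a universal vertex. -/
theorem IsMinorOf.exists_universal {n : ℕ} [Finite V] (h : (wheel n).IsMinorOf G)
    (hn : n ≠ 0) (hc : Nat.card V = n + 1) : ∃ u, ∀ w, w ≠ u → G.Adj u w := by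
  have : NeZero n := ⟨hn⟩
  obtain ⟨f⟩ := h.isContained (by simp [hc])
  have hsurj : Function.Surjective f := (f.injective.bijective_of_nat_card_le (by simp [hc])).2
  refine ⟨f none, fun w hw => ?_⟩
  obtain ⟨a, rfl⟩ := hsurj w
  refine f.toHom.map_adj ?_
  have ha : a ≠ none := fun h => hw (congrArg f h)
  simp [wheel, ha, ha.symm]

theorem not_wheel_isMinorOf_of_iso {n : ℕ} [Finite W] (e : G ≃g H) (hn : n ≠ 0)
    (hc : Nat.card W = n + 1) (hH : ∀ u, ∃ w, w ≠ u ∧ ¬ H.Adj u w) :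
    ¬ (wheel n).IsMinorOf G := by
  intro h
  have : Finite V := Finite.of_equiv _ e.toEquiv.symm
  obtain ⟨u, hu⟩ := h.exists_universal hn (by rw [Nat.card_congr e.toEquiv, hc])
  obtain ⟨w, hw, hadj⟩ := hH (e u)
  refine hadj ?_
  obtain ⟨w, rfl⟩ := e.surjective w
  exact e.map_adj_iff.2 (hu w fun h => hw (congrArg e h))

section Split

variable {v : V} {X Y : Set V}

@[simp]
theorem splitGraph_adj_inl_inl {a b : {u // u ≠ v}} :
    (splitGraph G v X Y).Adj (.inl a) (.inl b) ↔ G.Adj a b := by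
  simp only [splitGraph, fromRel_adj, ne_eq, Sum.inl.injEq, G.adj_comm b, or_self]
  exact and_iff_right_of_imp fun h hab => h.ne (congrArg _ hab)

@[simp]
theorem splitGraph_adj_inl_inr_zero {a : {u // u ≠ v}} :
    (splitGraph G v X Y).Adj (.inl a) (.inr 0) ↔ (a : V) ∈ X := by
  simp [splitGraph]

@[simp]
theorem splitGraph_adj_inl_inr_one {a : {u // u ≠ v}} :
    (splitGraph G v X Y).Adj (.inl a) (.inr 1) ↔ (a : V) ∈ Y := by
  simp [splitGraph]

@[simp]
theorem splitGraph_adj_inr_inl {a : {u // u ≠ v}} {i : Fin 2} :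
    (splitGraph G v X Y).Adj (.inr i) (.inl a) ↔
      (splitGraph G v X Y).Adj (.inl a) (.inr i) :=
  adj_comm ..

@[simp]
theorem splitGraph_adj_inr_inr {i j : Fin 2} :
    (splitGraph G v X Y).Adj (.inr i) (.inr j) ↔ i ≠ j := by
  simp [splitGraph]

variable (G v X Y) in
/-- Exchanging the two new vertices of a split. -/
def splitGraphComm : splitGraph G v X Y ≃g splitGraph G v Y X where
  toEquiv := (Equiv.refl _).sumCongr (Equiv.swap 0 1)
  map_rel_iff' := by
    rintro (a | i) (b | j)
    · simp
    · fin_cases j <;> simp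
    · fin_cases i <;> simp
    · simp

/-- A split along a vertex `v` contains `W₆` if some common neighbour `u` of the two new vertices
is joined to all vertices of a path `p r s q` of `G - v` whose ends lie in `X` and `Y`. -/
theorem wheel_six_isContained_splitGraph {u p q r s : V} (hnd : [v, u, p, r, s, q].Nodup)
    (huX : u ∈ X) (huY : u ∈ Y) (hp : p ∈ X) (hq : q ∈ Y) (hpr : G.Adj p r) (hrs : G.Adj r s)
    (hsq : G.Adj s q) (hu : ∀ w ∈ [p, r, s, q], G.Adj u w) :
    wheel 6 ⊑ splitGraph G v X Y := by
  simp only [List.nodup_cons, List.mem_cons, List.not_mem_nil, or_false, not_or] at hnd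
  obtain ⟨⟨hvu, hvp, hvr, hvs, hvq⟩, -, ⟨hpr', hps, hpq⟩, ⟨hrs', hrq⟩, hsq', -⟩ := hnd
  simp only [List.mem_cons, List.not_mem_nil, or_false, forall_eq_or_imp, forall_eq] at hu
  obtain ⟨hup, hur, hus, huq⟩ := hu
  let c : Fin 6 → {u // u ≠ v} ⊕ Fin 2 :=
    ![.inl ⟨p, Ne.symm hvp⟩, .inl ⟨r, Ne.symm hvr⟩, .inl ⟨s, Ne.symm hvs⟩,
      .inl ⟨q, Ne.symm hvq⟩, .inr 1, .inr 0]
  refine wheel_isContained (.inl ⟨u, Ne.symm hvu⟩) c ?_ (fun i => ?_) (fun i => ?_)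
  · intro i j hij
    change Fin 6 at i j
    fin_cases i <;> fin_cases j <;> first | rfl | (exfalso; simp_all [c])
  · change Fin 6 at i
    fin_cases i
    · exact splitGraph_adj_inl_inl.2 hpr
    · exact splitGraph_adj_inl_inl.2 hrs
    · exact splitGraph_adj_inl_inl.2 hsq
    · exact splitGraph_adj_inl_inr_one.2 hq
    · exact splitGraph_adj_inr_inr.2 (by decide)
    · exact splitGraph_adj_inr_inl.2 (splitGraph_adj_inl_inr_zero.2 hp)
  · change Fin 6 at i
    fin_cases i
    · exact splitGraph_adj_inl_inl.2 hup
    · exact splitGraph_adj_inl_inl.2 hur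
    · exact splitGraph_adj_inl_inl.2 hus
    · exact splitGraph_adj_inl_inl.2 huq
    · exact splitGraph_adj_inl_inr_one.2 huY
    · exact splitGraph_adj_inl_inr_zero.2 huX

end Split

end SimpleGraph

theorem K6e_adj {a b : Fin 6} : K6e.Adj a b ↔ a ≠ b ∧ s(a, b) ≠ s(0, 1) := by
  simp [K6e]

instance : DecidableRel K6e.Adj := fun _ _ => decidable_of_iff _ K6e_adj.symm

theorem exists_not_adj_K43_31 : ∀ u, ∃ w, w ≠ u ∧ ¬ K43_31.Adj u w := by
  simp [K43_31]
  decide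

theorem exists_not_adj_K43_41 : ∀ u, ∃ w, w ≠ u ∧ ¬ K43_41.Adj u w := by
  simp [K43_41]
  decide

/-- Given a universal vertex `u` and another vertex `v` of `K₆` minus an edge, any two other
vertices `p`, `q` are the ends of a Hamiltonian path of the graph without `u` and `v`, except if
this graph is not complete and both `p` and `q` are universal. -/
theorem exists_path_K6e : ∀ v u p q : Fin 6, [v, u, p, q].Nodup → 1 < u → (v ≤ 1 ∨ p ≤ 1 ∨ q ≤ 1) →
    ∃ r s, [v, u, p, r, s, q].Nodup ∧ K6e.Adj p r ∧ K6e.Adj r s ∧ K6e.Adj s q := by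
  decide +kernel

theorem K6e_adj_of_one_lt : ∀ {u w : Fin 6}, 1 < u → u ≠ w → K6e.Adj u w := by
  decide

/-- The isomorphisms onto `K43_31` and `K43_41` differ only in whether `f ∈ Y`. -/
theorem exists_iso_K43 {v a b c e f : Fin 6} {X Y : Set (Fin 6)} (hnd : [v, a, b, c, e, f].Nodup)
    (hef : s(e, f) = s(0, 1)) (hX : X = {e, f, a}) (hY : Y \ {f} = {e, b, c}) :
    Nonempty (splitGraph K6e v X Y ≃g K43_31) ∨ Nonempty (splitGraph K6e v X Y ≃g K43_41) := by
  have hmemY : ∀ w, w ≠ f → (w ∈ Y ↔ w = e ∨ w = b ∨ w = c) := fun w hw => by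
    simpa [hw] using Set.ext_iff.1 hY w
  simp only [List.nodup_cons, List.mem_cons, List.not_mem_nil, or_false, not_or] at hnd
  obtain ⟨⟨hva, hvb, hvc, hve, hvf⟩, ⟨hab, hac, hae, haf⟩, ⟨hbc, hbe, hbf⟩, ⟨hce, hcf⟩, hef', -⟩ :=
    hnd
  let g : Fin 4 ⊕ Fin 3 → {u : Fin 6 // u ≠ v} ⊕ Fin 2 :=
    Sum.elim ![.inl ⟨f, Ne.symm hvf⟩, .inl ⟨a, Ne.symm hva⟩, .inl ⟨e, Ne.symm hve⟩, .inr 1]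
      ![.inl ⟨b, Ne.symm hvb⟩, .inl ⟨c, Ne.symm hvc⟩, .inr 0]
  have hinj : Function.Injective g := by
    rintro (i | i) (j | j) hij <;> fin_cases i <;> fin_cases j <;>
      first | rfl | (exfalso; simp_all [g])
  have hbij : Function.Bijective g := hinj.bijective_of_nat_card_le (by simp)
  have hadj : ∀ w, w ≠ e → w ≠ f → ∀ w', K6e.Adj w w' ↔ w ≠ w' := fun w hwe hwf w' => by
    rw [K6e_adj, ← hef]
    simp [hwe, hwf]
  have hadj' : ∀ w, w ≠ e → w ≠ f → ∀ w', K6e.Adj w' w ↔ w ≠ w' := fun w hwe hwf w' => by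
    rw [adj_comm, hadj w hwe hwf]
  have hnadj : ¬ K6e.Adj e f := by simp [K6e_adj, ← hef]
  have hnadj' : ¬ K6e.Adj f e := fun h => hnadj h.symm
  have haX : a ∈ X := by simp [hX]
  have heX : e ∈ X := by simp [hX]
  have hfX : f ∈ X := by simp [hX]
  have hbX : b ∉ X := by simp [hX, hbe, hbf, Ne.symm hab]
  have hcX : c ∉ X := by simp [hX, hce, hcf, Ne.symm hac]
  have haY : a ∉ Y := by simp [hmemY a haf, hab, hac, hae]
  have hbY : b ∈ Y := by simp [hmemY b hbf]
  have hcY : c ∈ Y := by simp [hmemY c hcf]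
  have heY : e ∈ Y := by simp [hmemY e hef']
  clear hX hY hmemY hinj hef
  by_cases hfY : f ∈ Y
  · refine .inr ⟨RelIso.symm ⟨Equiv.ofBijective g hbij, ?_⟩⟩
    rintro (i | i) (j | j) <;> fin_cases i <;> fin_cases j <;>
      simp [g, K43_41, *, Ne.symm hab, Ne.symm hac, Ne.symm hbc]
  · refine .inl ⟨RelIso.symm ⟨Equiv.ofBijective g hbij, ?_⟩⟩
    rintro (i | i) (j | j) <;> fin_cases i <;> fin_cases j <;>
      simp [g, K43_31, *, Ne.symm hab, Ne.symm hac, Ne.symm hbc]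

theorem Set.ncard_pair_le {α : Type*} (a b : α) : ({a, b} : Set α).ncard ≤ 2 := by
  simpa using Set.ncard_insert_le a {b}

theorem exists_mem_ne_ne {α : Type*} {Z : Set α} (hZ : 3 ≤ Z.ncard) (a b : α) :
    ∃ z ∈ Z, z ≠ a ∧ z ≠ b := by
  by_contra! h
  have hsub : Z ⊆ {a, b} := fun z hz => or_iff_not_imp_left.2 (h z hz)
  have := (Set.ncard_le_ncard hsub).trans (Set.ncard_pair_le a b)
  omega

theorem wheel_six_isMinorOf_splitGraph_K6e {v u : Fin 6} {X Y : Set (Fin 6)}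
    (h : IsSplitData K6e v X Y) (hu : 1 < u) (huX : u ∈ X) (huY : u ∈ Y) :
    (wheel 6).IsMinorOf (splitGraph K6e v X Y) := by
  obtain ⟨hXN, hYN, hXY, hX, hY⟩ := h
  have hpq : ∃ p ∈ X, ∃ q ∈ Y, p ≠ u ∧ q ≠ u ∧ p ≠ q ∧ (v ≤ 1 ∨ p ≤ 1 ∨ q ≤ 1) := by
    rcases le_or_gt v 1 with hv | hv
    · obtain ⟨p, hp, hpu, -⟩ := exists_mem_ne_ne hX u u
      obtain ⟨q, hq, hqu, hqp⟩ := exists_mem_ne_ne hY u p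
      exact ⟨p, hp, q, hq, hpu, hqu, hqp.symm, .inl hv⟩
    · have h0u : (0 : Fin 6) ≠ u := by rintro rfl; exact absurd hu (by decide)
      have h0 : (0 : Fin 6) ∈ X ∪ Y := by
        rw [hXY]
        exact K6e_adj_of_one_lt hv (by rintro rfl; exact absurd hv (by decide))
      rcases h0 with h0 | h0
      · obtain ⟨q, hq, hqu, hq0⟩ := exists_mem_ne_ne hY u 0
        exact ⟨0, h0, q, hq, h0u, hqu, hq0.symm, by simp⟩
      · obtain ⟨p, hp, hpu, hp0⟩ := exists_mem_ne_ne hX u 0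
        exact ⟨p, hp, 0, h0, hpu, h0u, hp0, by simp⟩
  obtain ⟨p, hp, q, hq, hpu, hqu, hpq, hle⟩ := hpq
  have hvu : v ≠ u := K6e.ne_of_adj (hXN huX)
  have hvp : v ≠ p := K6e.ne_of_adj (hXN hp)
  have hvq : v ≠ q := K6e.ne_of_adj (hYN hq)
  obtain ⟨r, s, hnd, hpr, hrs, hsq⟩ :=
    exists_path_K6e v u p q (by simp [hvu, hvp, hvq, hpu.symm, hqu.symm, hpq]) hu hle
  refine (wheel_six_isContained_splitGraph hnd huX huY hp hq hpr hrs hsq fun w hw => ?_).isMinorOf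
  exact K6e_adj_of_one_lt hu fun huw => (List.nodup_cons.1 hnd.of_cons).1 (huw ▸ hw)

theorem exists_iso_K43_of_diff_eq_singleton {v a : Fin 6} {X Y : Set (Fin 6)} (hv : 1 < v)
    (h : IsSplitData K6e v X Y) (hdisj : Disjoint (X \ {0, 1}) (Y \ {0, 1}))
    (ha : X \ {0, 1} = {a}) (hcard : (Y \ {0, 1}).ncard = 2) :
    Nonempty (splitGraph K6e v X Y ≃g K43_31) ∨ Nonempty (splitGraph K6e v X Y ≃g K43_41) := by
  obtain ⟨hXN, hYN, -, hX, hY⟩ := h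
  obtain ⟨b, c, hbc, hbcY⟩ := Set.ncard_eq_two.1 hcard
  have ha' : a ∈ X \ {0, 1} := ha ▸ rfl
  have hb' : b ∈ Y \ {0, 1} := hbcY ▸ .inl rfl
  have hc' : c ∈ Y \ {0, 1} := hbcY ▸ .inr rfl
  have hab : a ≠ b := hdisj.ne_of_mem ha' hb'
  have hac : a ≠ c := hdisj.ne_of_mem ha' hc'
  have hva : v ≠ a := K6e.ne_of_adj (hXN ha'.1)
  have hvb : v ≠ b := K6e.ne_of_adj (hYN hb'.1)
  have hvc : v ≠ c := K6e.ne_of_adj (hYN hc'.1)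
  have hX' : X = {0, 1, a} := by
    refine Set.eq_of_subset_of_ncard_le (fun x hx => ?_) ?_
    · by_cases h01 : x ∈ ({0, 1} : Set (Fin 6))
      · rcases h01 with rfl | rfl <;> simp
      · have hxa : x ∈ X \ {0, 1} := ⟨hx, h01⟩
        rw [ha] at hxa
        exact .inr (.inr hxa)
    · exact (Set.ncard_insert_le _ _).trans ((Nat.succ_le_succ (Set.ncard_pair_le _ _)).trans hX)
  have hmemY : ∀ w, w ∈ Y ∧ ¬ (w = 0 ∨ w = 1) ↔ w = b ∨ w = c := Set.ext_iff.1 hbcY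
  obtain ⟨e, heY, heb, hec⟩ := exists_mem_ne_ne hY b c
  have he : e = 0 ∨ e = 1 := by
    by_contra he
    exact ((hmemY e).1 ⟨heY, he⟩).elim heb hec
  have ha01 := ha'.2
  have hb01 := hb'.2
  have hc01 := hc'.2
  simp only [Set.mem_insert_iff, Set.mem_singleton_iff, not_or] at ha01 hb01 hc01
  rcases he with rfl | rfl
  · refine exists_iso_K43 (a := a) (b := b) (c := c) (e := 0) (f := 1) ?_ rfl hX' ?_
    · simp [*, hv.ne', (Fin.zero_lt_one.trans hv).ne']
    · ext w
      have := hmemY w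
      simp only [Set.mem_sdiff, Set.mem_singleton_iff, Set.mem_insert_iff]
      grind
  · refine exists_iso_K43 (a := a) (b := b) (c := c) (e := 1) (f := 0) ?_ Sym2.eq_swap
      (hX'.trans (Set.insert_comm ..)) ?_
    · simp [*, hv.ne', (Fin.zero_lt_one.trans hv).ne']
    · ext w
      have := hmemY w
      simp only [Set.mem_sdiff, Set.mem_singleton_iff, Set.mem_insert_iff]
      grind

theorem exists_iso_K43_of_inter_le_one {v : Fin 6} {X Y : Set (Fin 6)}
    (h : IsSplitData K6e v X Y) (hXY : ∀ u ∈ X, u ∈ Y → u ≤ 1) :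
    Nonempty (splitGraph K6e v X Y ≃g K43_31) ∨ Nonempty (splitGraph K6e v X Y ≃g K43_41) := by
  have ⟨hXN, hYN, hunion, hX, hY⟩ := h
  have hv : 1 < v := by
    by_contra! hv
    have hnadj : ∀ v u : Fin 6, v ≤ 1 → u ≤ 1 → ¬ K6e.Adj v u := by decide
    have hdisj : Disjoint X Y := Set.disjoint_left.2 fun u huX huY =>
      hnadj v u hv (hXY u huX huY) (hXN huX)
    have hcard := Set.ncard_union_eq hdisj
    have hlt : (X ∪ Y).ncard < Nat.card (Fin 6) := Set.ncard_lt_card fun huniv => by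
      have hvN : v ∈ K6e.neighborSet v := hunion ▸ huniv ▸ Set.mem_univ v
      exact K6e.irrefl hvN
    rw [Nat.card_fin] at hlt
    omega
  have hdisj : Disjoint (X \ {0, 1}) (Y \ {0, 1}) := Set.disjoint_left.2 fun u huX huY => by
    have hle : ∀ u : Fin 6, u ≤ 1 → u = 0 ∨ u = 1 := by decide
    exact huX.2 (hle u (hXY u huX.1 huY.1))
  have hsum : (X \ {0, 1}).ncard + (Y \ {0, 1}).ncard = 3 := by
    have hN : K6e.neighborSet v \ {0, 1} = ↑({v, 0, 1}ᶜ : Finset (Fin 6)) := by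
      ext w
      have hw : w ≠ v → K6e.Adj v w := fun hw => K6e_adj_of_one_lt hv hw.symm
      have hw' : K6e.Adj v w → w ≠ v := fun hw => hw.ne'
      simp
      tauto
    rw [← Set.ncard_union_eq hdisj, ← Set.union_sdiff_distrib, hunion, hN, Set.ncard_coe_finset,
      Finset.card_compl]
    have hv3 : ({v, 0, 1} : Finset (Fin 6)).card = 3 :=
      Finset.card_eq_three.2 ⟨v, 0, 1, (Fin.zero_lt_one.trans hv).ne', hv.ne', by decide, rfl⟩
    simp [hv3]
  have hX1 := Set.le_ncard_sdiff {0, 1} X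
  have hY1 := Set.le_ncard_sdiff {0, 1} Y
  rw [Set.ncard_pair (by decide)] at hX1 hY1
  obtain hX2 | hY2 : (X \ {0, 1}).ncard = 1 ∨ (Y \ {0, 1}).ncard = 1 := by omega
  · obtain ⟨a, ha⟩ := Set.ncard_eq_one.1 hX2
    exact exists_iso_K43_of_diff_eq_singleton hv h hdisj ha (by omega)
  · obtain ⟨a, ha⟩ := Set.ncard_eq_one.1 hY2
    have h' : IsSplitData K6e v Y X := ⟨hYN, hXN, Set.union_comm X Y ▸ hunion, hY, hX⟩
    exact (exists_iso_K43_of_diff_eq_singleton hv h' hdisj.symm ha (by omega)).imp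
      (.map (splitGraphComm K6e v X Y).trans) (.map (splitGraphComm K6e v X Y).trans)

theorem stmt16 (v : Fin 6) (X Y : Set (Fin 6)) (h : IsSplitData K6e v X Y) :
    ¬ (wheel 6).IsMinorOf (splitGraph K6e v X Y) ↔
      (Nonempty (splitGraph K6e v X Y ≃g K43_31) ∨
        Nonempty (splitGraph K6e v X Y ≃g K43_41)) := by
  refine ⟨fun hminor => exists_iso_K43_of_inter_le_one h fun u huX huY => ?_, ?_⟩
  · by_contra! hu
    exact hminor (wheel_six_isMinorOf_splitGraph_K6e h hu huX huY)
  · rintro (⟨⟨e⟩⟩ | ⟨⟨e⟩⟩)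
    · exact not_wheel_isMinorOf_of_iso e (by decide) (by simp) exists_not_adj_K43_31
    · exact not_wheel_isMinorOf_of_iso e (by decide) (by simp) exists_not_adj_K43_41
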